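/- Let n and x be positive integers. Then det( δ_{ij} + C(2x+1+i+j, i) )_{0≤i,j≤2n-2} = [ (x-1)! · (2x+2n)_n / (x+n-1)! ] · ∏_{i=0}^{n-1} [ (i!)² · ((2x+2i)_i)² · (x+i)! · (x+2i)_{i+1} · (x+2i+1)_i / ( ((2i)!)² · (x+n+i)! ) ]. -/

import Mathlib

open Finset

/-- Binomial coefficient `C(m,k)` for `m : ℕ` and `k : ℤ`, zero if `k < 0` or `k > m`. -/
def C (m : ℕ) (k : ℤ) : ℚ := if 0 ≤ k then (m.choose k.toNat : ℚ) else 0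

/-- The shifted factorial (ascending Pochhammer): `(a)_k = a(a+1)⋯(a+k-1)`, as a rational. -/
def asc (a k : ℕ) : ℚ := ∏ m ∈ Finset.range k, ((a : ℚ) + m)

/-- The determinant of the leading `n × n` section of an infinite array. -/
def sectionDet {R : Type*} [CommRing R] (n : ℕ) (f : ℕ → ℕ → R) : R :=
  Matrix.det (Matrix.of fun i j : Fin n => f i j)

section Condensation

variable {R : Type*} [CommRing R]

/-- The middle indices followed by the two extreme ones. -/
noncomputable def middleEndsEquiv (k : ℕ) : Fin k ⊕ Fin 2 ≃ Fin (k + 2) :=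
  Equiv.ofBijective (Sum.elim (fun i => i.succ.castSucc) ![0, Fin.last (k + 1)]) (by
    rw [Fintype.bijective_iff_injective_and_card]
    refine ⟨?_, by simp⟩
    rintro (i | i) (j | j) h
    · simpa [Fin.ext_iff] using h
    · have := i.isLt
      fin_cases j <;> simp [Fin.ext_iff] at h
      omega
    · have := j.isLt
      fin_cases i <;> simp [Fin.ext_iff] at h
      omega
    · fin_cases i <;> fin_cases j <;> simp [Fin.ext_iff] at h ⊢)

theorem det_one_replace_end_cols (k : ℕ) (a b : Fin (k + 2) → R) :
    Matrix.det (Matrix.of fun i j : Fin (k + 2) =>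
      if j = 0 then a i else if j = Fin.last (k + 1) then b i else if i = j then 1 else 0) =
      a 0 * b (Fin.last _) - a (Fin.last _) * b 0 := by
  rw [← Matrix.det_submatrix_equiv_self (middleEndsEquiv k)]
  have : (Matrix.of fun i j : Fin (k + 2) =>
      if j = 0 then a i else if j = Fin.last (k + 1) then b i
        else if i = j then (1 : R) else 0).submatrix (middleEndsEquiv k) (middleEndsEquiv k) =
      Matrix.fromBlocks 1
        (Matrix.of fun i => ![a i.succ.castSucc, b i.succ.castSucc])
        0 !![a 0, b 0; a (Fin.last _), b (Fin.last _)] := by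
    have h0 : ∀ i : Fin k, i.succ.castSucc ≠ 0 := fun i => by simp
    have hl : ∀ i : Fin k, i.succ.castSucc ≠ Fin.last (k + 1) := fun i => Fin.castSucc_ne_last _
    have h0l : (0 : Fin (k + 2)) ≠ Fin.last (k + 1) := by simp
    ext i j
    rcases i with i | i <;> rcases j with j | j
    · have e : (i.succ.castSucc = j.succ.castSucc) ↔ i = j := by simp
      simp only [middleEndsEquiv, Matrix.submatrix_apply, Equiv.ofBijective_apply, Sum.elim_inl,
        Matrix.of_apply, h0, hl, if_false, e, Matrix.fromBlocks_apply₁₁, Matrix.one_apply]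
    · fin_cases j <;> simp [middleEndsEquiv, h0l.symm]
    · fin_cases i
      · exact ((if_neg (t := a 0) (h0 j)).trans (if_neg (hl j))).trans (if_neg (h0 j).symm)
      · exact ((if_neg (t := a 0) (h0 j)).trans (if_neg (hl j))).trans (if_neg (hl j).symm)
    · fin_cases i <;> fin_cases j <;> simp [middleEndsEquiv, h0l.symm]
  rw [this, Matrix.det_fromBlocks_zero₂₁, Matrix.det_one, one_mul, Matrix.det_fin_two_of]
  ring

theorem det_mul_condensation (k : ℕ) (M : Matrix (Fin (k + 2)) (Fin (k + 2)) R) :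
    M.det * (M.submatrix Fin.castSucc Fin.castSucc).det * (M.submatrix Fin.succ Fin.succ).det -
      M.det * (M.submatrix Fin.succ Fin.castSucc).det * (M.submatrix Fin.castSucc Fin.succ).det =
    M.det * (M.det * (M.submatrix (fun i : Fin k => i.succ.castSucc)
      (fun i : Fin k => i.succ.castSucc)).det) := by
  have hQ := det_one_replace_end_cols k (fun i => M.adjugate i 0)
    (fun i => M.adjugate i (Fin.last _))
  set Q := (Matrix.of fun i j : Fin (k + 2) =>
      if j = 0 then M.adjugate i 0 else if j = Fin.last (k + 1) then M.adjugate i (Fin.last _)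
        else if i = j then (1 : R) else 0) with hQdef
  have hMQ : M * Q = Matrix.of fun i j : Fin (k + 2) =>
      if j = 0 then (if i = 0 then M.det else 0)
      else if j = Fin.last (k + 1) then (if i = Fin.last (k + 1) then M.det else 0)
      else M i j := by
    ext i j
    rw [Matrix.mul_apply]
    have h := M.mul_adjugate
    have h' : ∀ l, ∑ m, M i m * M.adjugate m l = if i = l then M.det else 0 := by
      intro l
      have := congrFun (congrFun h i) l
      rw [Matrix.mul_apply] at this
      simpa [Matrix.one_apply] using this
    by_cases h0 : j = 0
    · simpa [hQdef, h0] using h' 0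
    · by_cases h1 : j = Fin.last _
      · simpa [hQdef, h0, h1] using h' (Fin.last _)
      · simp [hQdef, h0, h1]
  have hdet : (M * Q).det = M.det * (M.det * (M.submatrix (fun i : Fin k => i.succ.castSucc)
      (fun i : Fin k => i.succ.castSucc)).det) := by
    rw [hMQ, Matrix.det_succ_column_zero, Fin.sum_univ_succ]
    rw [Matrix.det_succ_column _ (Fin.last k), Fin.sum_univ_castSucc]
    have h0l : (0 : Fin (k + 2)) ≠ Fin.last (k + 1) := by simp
    have e1 : ∀ x : Fin k, x.succ.castSucc ≠ 0 := fun x => by simp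
    have e2 : ∀ x : Fin k, x.succ.castSucc ≠ Fin.last (k + 1) := fun x => Fin.castSucc_ne_last _
    simp
    congr 3
    ext i j
    exact (if_neg (t := if i.succ.castSucc = 0 then M.det else 0) (e1 j)).trans (if_neg (e2 j))
  rw [← hdet, Matrix.det_mul, hQ]
  simp only [Matrix.adjugate_fin_succ_eq_det_submatrix]
  have hz : (Fin.succAbove (0 : Fin (k + 2))) = Fin.succ := by ext; simp
  have hl : (Fin.succAbove (Fin.last (k + 1))) = Fin.castSucc := by ext; simp
  simp only [hz, hl]
  have : ((-1 : R) ^ (k + 1)) * (-1) ^ (k + 1) = 1 := by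
    rw [← mul_pow]; simp
  simp
  linear_combination (M.det * (M.submatrix Fin.succ Fin.castSucc).det *
    (M.submatrix Fin.castSucc Fin.succ).det) * this

/-- Desnanot–Jacobi identity. -/
theorem det_condensation (k : ℕ) (M : Matrix (Fin (k + 2)) (Fin (k + 2)) R) :
    M.det * (M.submatrix (fun i : Fin k => i.succ.castSucc)
      (fun i : Fin k => i.succ.castSucc)).det =
    (M.submatrix Fin.castSucc Fin.castSucc).det * (M.submatrix Fin.succ Fin.succ).det -
      (M.submatrix Fin.succ Fin.castSucc).det * (M.submatrix Fin.castSucc Fin.succ).det := by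
  have h := det_mul_condensation k (Matrix.mvPolynomialX (Fin (k + 2)) (Fin (k + 2)) ℤ)
  rw [mul_assoc, mul_assoc, ← mul_sub] at h
  have h2 := mul_left_cancel₀ (Matrix.det_mvPolynomialX_ne_zero (Fin (k + 2)) ℤ) h.symm
  let φ : MvPolynomial (Fin (k + 2) × Fin (k + 2)) ℤ →+* R :=
    MvPolynomial.eval₂Hom (Int.castRingHom R) (fun p => M p.1 p.2)
  have hφ : (Matrix.mvPolynomialX (Fin (k + 2)) (Fin (k + 2)) ℤ).map φ = M :=
    Matrix.mvPolynomialX_map_eval₂ _ _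
  have h3 := congrArg φ h2
  have hs : ∀ {l : ℕ} (u v : Fin l → Fin (k + 2)),
      φ ((Matrix.mvPolynomialX (Fin (k + 2)) (Fin (k + 2)) ℤ).submatrix u v).det =
        (M.submatrix u v).det := by
    intro l u v
    rw [RingHom.map_det, RingHom.mapMatrix_apply, ← Matrix.submatrix_map, hφ]
  rw [map_sub, map_mul, map_mul, map_mul, hs, hs, hs, hs, hs, RingHom.map_det,
    RingHom.mapMatrix_apply, hφ] at h3
  exact h3

theorem sectionDet_condensation (k : ℕ) (f : ℕ → ℕ → R) :
    sectionDet (k + 2) f * sectionDet k (fun i j => f (i + 1) (j + 1)) =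
      sectionDet (k + 1) f * sectionDet (k + 1) (fun i j => f (i + 1) (j + 1)) -
      sectionDet (k + 1) (fun i j => f (i + 1) j) * sectionDet (k + 1) (fun i j => f i (j + 1)) :=
  det_condensation k (Matrix.of fun i j : Fin (k + 2) => f i j)

end Condensation

theorem asc_pos {a : ℕ} (ha : 0 < a) (k : ℕ) : 0 < asc a k :=
  Finset.prod_pos fun i _ => by positivity

theorem asc_succ_left (a k : ℕ) : asc a (k + 1) = a * asc (a + 1) k := by
  rw [asc, Finset.prod_range_succ', mul_comm, asc]
  congr 1
  · simp
  · refine Finset.prod_congr rfl fun i _ => ?_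
    push_cast; ring

theorem factorial_mul_asc (a k : ℕ) : (a.factorial : ℚ) * asc (a + 1) k = (a + k).factorial := by
  induction k with
  | zero => simp [asc]
  | succ k ih =>
    rw [asc, Finset.prod_range_succ, ← asc, ← mul_assoc, ih, ← add_assoc, Nat.factorial_succ]
    push_cast; ring

theorem factorial_sub_mul_prod {a k : ℕ} (h : k ≤ a) :
    ((a - k).factorial : ℚ) * ∏ l ∈ Finset.range k, ((a : ℚ) - l) = a.factorial := by
  induction k with
  | zero => simp
  | succ k ih =>
    rw [← ih (by omega), Finset.prod_range_succ, show a - k = a - (k + 1) + 1 by omega,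
      Nat.factorial_succ, show a - (k + 1) + 1 = a - k by omega]
    push_cast [show k ≤ a by omega]; ring

theorem sectionDet_mul_row_mul_column {R : Type*} [CommRing R] (n : ℕ) (a b : ℕ → R)
    (f : ℕ → ℕ → R) :
    sectionDet n (fun i j => a i * (b j * f i j)) =
      (∏ i ∈ range n, a i) * ((∏ j ∈ range n, b j) * sectionDet n f) := by
  rw [← Fin.prod_univ_eq_prod_range a, ← Fin.prod_univ_eq_prod_range b, sectionDet, sectionDet,
    ← Matrix.det_mul_row, ← Matrix.det_mul_column]
  rfl

section Krattenthaler

/-- The factor by which the closed form of the determinant `det (krattEntry x y)` grows from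
size `i` to size `i + 1`. -/
def krattFactor (x y i : ℕ) : ℚ :=
  i.factorial * (x + y + i - 1).factorial * asc (2 * x + y + 2 * i) i * asc (x + 2 * y + 2 * i) i /
    ((x + 2 * i).factorial * (y + 2 * i).factorial)

/-- Entries of Krattenthaler's determinant. -/
def krattEntry (x y i j : ℕ) : ℚ :=
  (x + y + i + j - 1).factorial / ((x + 2 * i - j).factorial * (y + 2 * j - i).factorial)

theorem krattFactor_pos {x y : ℕ} (hx : 0 < x) (i : ℕ) : 0 < krattFactor x y i := by
  have h1 := asc_pos (a := 2 * x + y + 2 * i) (by omega) i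
  have h2 := asc_pos (a := x + 2 * y + 2 * i) (by omega) i
  unfold krattFactor
  positivity

theorem prod_krattFactor_shift (u v n : ℕ) :
    (∏ i ∈ range (n + 1), krattFactor (u + 3) v i) *
      (∏ i ∈ range (n + 1), krattFactor u (v + 3) i) =
    (∏ i ∈ range (n + 1), krattFactor (u + 1) (v + 1) i) *
      (∏ i ∈ range n, krattFactor (u + 2) (v + 2) i) *
      (n.factorial * (u + v + 2) * (u + v + 2 + n).factorial * (u + 1) * (v + 1) *
        asc (2 * u + v + 6 + 2 * n) n * asc (u + 2 * v + 6 + 2 * n) n /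
        ((u + 3 + 2 * n).factorial * (v + 3 + 2 * n).factorial)) := by
  induction n with
  | zero =>
    have h1 : ((u + v + 2).factorial : ℚ) = (u + v + 2) * (u + v + 1).factorial := by
      rw [Nat.factorial_succ]; push_cast; ring
    have h2 : ((u + 1).factorial : ℚ) = (u + 1) * u.factorial := by
      rw [Nat.factorial_succ]; push_cast; ring
    have h3 : ((v + 1).factorial : ℚ) = (v + 1) * v.factorial := by
      rw [Nat.factorial_succ]; push_cast; ring
    simp only [krattFactor, asc, zero_add, prod_range_one, prod_range_zero, mul_zero, add_zero,
      mul_one, one_mul, Nat.factorial_zero, Nat.cast_one]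
    rw [show u + (v + 3) - 1 = u + v + 2 by omega, show u + 3 + v - 1 = u + v + 2 by omega,
      show u + 1 + (v + 1) - 1 = u + v + 1 by omega, h1, h2, h3]
    field_simp
  | succ n ih =>
    rw [prod_range_succ _ (n + 1), prod_range_succ (krattFactor u (v + 3)) (n + 1),
      prod_range_succ (krattFactor (u + 1) (v + 1)) (n + 1),
      prod_range_succ (krattFactor (u + 2) (v + 2)) n, mul_mul_mul_comm, ih]
    generalize ∏ i ∈ range (n + 1), krattFactor (u + 1) (v + 1) i = p
    generalize ∏ i ∈ range n, krattFactor (u + 2) (v + 2) i = q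
    simp only [krattFactor]
    rw [show u + 3 + v + (n + 1) - 1 = u + v + 2 + (n + 1) by omega,
      show u + (v + 3) + (n + 1) - 1 = u + v + 2 + (n + 1) by omega,
      show u + 1 + (v + 1) + (n + 1) - 1 = u + v + 2 + n by omega,
      show u + 2 + (v + 2) + n - 1 = u + v + 2 + (n + 1) by omega,
      show 2 * (u + 3) + v + 2 * (n + 1) = 2 * u + v + 6 + 2 * (n + 1) by ring,
      show u + 3 + 2 * v + 2 * (n + 1) = u + 1 + 2 * (v + 1) + 2 * (n + 1) by ring,
      show 2 * u + (v + 3) + 2 * (n + 1) = 2 * (u + 1) + (v + 1) + 2 * (n + 1) by ring,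
      show u + 2 * (v + 3) + 2 * (n + 1) = u + 2 * v + 6 + 2 * (n + 1) by ring,
      show 2 * (u + 2) + (v + 2) + 2 * n = 2 * u + v + 6 + 2 * n by ring,
      show u + 2 + 2 * (v + 2) + 2 * n = u + 2 * v + 6 + 2 * n by ring,
      show u + 1 + 2 * (n + 1) = u + 3 + 2 * n by ring,
      show v + 1 + 2 * (n + 1) = v + 3 + 2 * n by ring,
      show u + 2 + 2 * n = u + 2 * (n + 1) by ring,
      show v + 2 + 2 * n = v + 2 * (n + 1) by ring]
    field_simp

theorem krattFactor_contiguous (u v n : ℕ) :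
    krattFactor (u + 1) (v + 1) (n + 1) = krattFactor (u + 2) (v + 2) n -
      (n.factorial * (u + v + 2) * (u + v + 2 + n).factorial * (u + 1) * (v + 1) *
        asc (2 * u + v + 6 + 2 * n) n * asc (u + 2 * v + 6 + 2 * n) n /
        ((u + 3 + 2 * n).factorial * (v + 3 + 2 * n).factorial)) := by
  simp only [krattFactor]
  rw [asc_succ_left, asc_succ_left,
      show u + 1 + (v + 1) + (n + 1) - 1 = u + v + 2 + n by omega,
      show u + 2 + (v + 2) + n - 1 = u + v + 2 + n + 1 by omega,
      show 2 * (u + 1) + (v + 1) + 2 * (n + 1) + 1 = 2 * u + v + 6 + 2 * n by ring,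
      show u + 1 + 2 * (v + 1) + 2 * (n + 1) + 1 = u + 2 * v + 6 + 2 * n by ring,
      show 2 * (u + 2) + (v + 2) + 2 * n = 2 * u + v + 6 + 2 * n by ring,
      show u + 2 + 2 * (v + 2) + 2 * n = u + 2 * v + 6 + 2 * n by ring,
      show u + 1 + 2 * (n + 1) = u + 2 + 2 * n + 1 by ring,
      show v + 1 + 2 * (n + 1) = v + 2 + 2 * n + 1 by ring,
      show u + 3 + 2 * n = u + 2 + 2 * n + 1 by ring,
      show v + 3 + 2 * n = v + 2 + 2 * n + 1 by ring]
  simp only [Nat.factorial_succ]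
  push_cast
  field_simp
  ring

theorem sectionDet_krattEntry (n : ℕ) : ∀ x y : ℕ, n ≤ x → n ≤ y →
    sectionDet n (krattEntry x y) = ∏ i ∈ range n, krattFactor x y i := by
  induction n using Nat.twoStepInduction with
  | zero => intros; simp [sectionDet]
  | one => intros; simp [sectionDet, krattEntry, krattFactor, asc]
  | more n ih1 ih2 =>
    intro x y hx hy
    obtain ⟨u, rfl⟩ : ∃ u, x = u + 1 := ⟨x - 1, by omega⟩
    obtain ⟨v, rfl⟩ : ∃ v, y = v + 1 := ⟨y - 1, by omega⟩
    have h := sectionDet_condensation n (krattEntry (u + 1) (v + 1))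
    have e1 : (fun i j => krattEntry (u + 1) (v + 1) (i + 1) (j + 1)) =
        krattEntry (u + 2) (v + 2) := by
      funext i j
      simp only [krattEntry]
      congr 3 <;> congr 1 <;> omega
    have e2 : (fun i j => krattEntry (u + 1) (v + 1) (i + 1) j) = krattEntry (u + 3) v := by
      funext i j
      simp only [krattEntry]
      congr 3 <;> congr 1 <;> omega
    have e3 : (fun i j => krattEntry (u + 1) (v + 1) i (j + 1)) = krattEntry u (v + 3) := by
      funext i j
      simp only [krattEntry]
      congr 3 <;> congr 1 <;> omega
    rw [e1, e2, e3, ih1 _ _ (by omega) (by omega), ih2 _ _ (by omega) (by omega),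
      ih2 _ _ (by omega) (by omega), ih2 _ _ (by omega) (by omega), ih2 _ _ (by omega) (by omega),
      prod_krattFactor_shift, prod_range_succ (krattFactor (u + 2) (v + 2)) n] at h
    have hpos : 0 < ∏ i ∈ range n, krattFactor (u + 2) (v + 2) i :=
      prod_pos fun i _ => krattFactor_pos (by omega) i
    rw [prod_range_succ _ (n + 1), krattFactor_contiguous]
    refine mul_right_cancel₀ hpos.ne' ?_
    rw [h]
    ring

/-- `krattEntry` with the row and column factors that are not polynomial in `x`, `y` removed. -/
def krattPoly {R : Type*} [CommRing R] (x y : R) (i j : ℕ) : R :=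
  (∏ k ∈ range i, (x + y + j + k)) * (∏ k ∈ range j, (x + 2 * i - k)) *
    ∏ k ∈ range i, (y + 2 * j - k)

/-- The quotient of consecutive determinants `det (krattPoly x y)`. -/
def krattPolyFactor {R : Type*} [CommRing R] (x y : R) (i : ℕ) : R :=
  i.factorial * (∏ k ∈ range i, (2 * x + y + 2 * i + k)) * ∏ k ∈ range i, (x + 2 * y + 2 * i + k)

theorem map_sectionDet_krattPoly {R S : Type*} [CommRing R] [CommRing S] (φ : R →+* S) (x y : R)
    (n : ℕ) :
    φ (sectionDet n (krattPoly x y)) = sectionDet n (krattPoly (φ x) (φ y)) := by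
  rw [sectionDet, RingHom.map_det, sectionDet]
  congr 1
  ext i j
  simp [krattPoly, map_ofNat φ 2]

theorem map_krattPolyFactor {R S : Type*} [CommRing R] [CommRing S] (φ : R →+* S) (x y : R)
    (i : ℕ) :
    φ (krattPolyFactor x y i) = krattPolyFactor (φ x) (φ y) i := by
  simp [krattPolyFactor, map_ofNat φ 2]

theorem krattPoly_natCast {x y i j : ℕ} (hxy : 0 < x + y) (hi : i ≤ y + 2 * j)
    (hj : j ≤ x + 2 * i) :
    krattPoly (x : ℚ) y i j =
      (x + 2 * i).factorial * (((y + 2 * j).factorial / (x + y + j - 1).factorial) *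
        krattEntry x y i j) := by
  have h1 := factorial_sub_mul_prod hj
  have h2 := factorial_sub_mul_prod hi
  have h3 := factorial_mul_asc (x + y + j - 1) i
  rw [show x + y + j - 1 + 1 = x + y + j by omega,
    show x + y + j - 1 + i = x + y + i + j - 1 by omega] at h3
  rw [krattEntry, ← h1, ← h2, ← h3, krattPoly, asc]
  push_cast
  field_simp

theorem sectionDet_krattPoly_natCast {n x y : ℕ} (hx : n ≤ x) (hy : n ≤ y) :
    sectionDet n (krattPoly (x : ℚ) y) = ∏ i ∈ range n, krattPolyFactor (x : ℚ) y i := by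
  have h : sectionDet n (krattPoly (x : ℚ) y) =
      (∏ i ∈ range n, ((x + 2 * i).factorial : ℚ)) *
      ((∏ j ∈ range n, ((y + 2 * j).factorial : ℚ) / (x + y + j - 1).factorial) *
        sectionDet n (krattEntry x y)) := by
    rw [← Fin.prod_univ_eq_prod_range (fun i => ((x + 2 * i).factorial : ℚ)),
      ← Fin.prod_univ_eq_prod_range (fun j => ((y + 2 * j).factorial : ℚ) /
        (x + y + j - 1).factorial), sectionDet, sectionDet, ← Matrix.det_mul_row,
      ← Matrix.det_mul_column]
    congr 1
    ext i j
    have := i.isLt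
    have := j.isLt
    exact krattPoly_natCast (by omega) (by omega) (by omega)
  rw [h, sectionDet_krattEntry n x y hx hy, ← prod_mul_distrib, ← prod_mul_distrib]
  refine prod_congr rfl fun i _ => ?_
  rw [krattFactor, krattPolyFactor, asc, asc]
  push_cast
  field_simp

theorem polynomial_eq_of_eval_natCast {p q : Polynomial ℚ} (n : ℕ)
    (h : ∀ k : ℕ, n ≤ k → p.eval (k : ℚ) = q.eval (k : ℚ)) : p = q := by
  refine Polynomial.eq_of_infinite_eval_eq p q ?_
  refine Set.infinite_of_injective_forall_mem (f := fun k : ℕ => ((n + k : ℕ) : ℚ)) ?_ ?_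
  · intro a b hab
    have : n + a = n + b := Nat.cast_injective hab
    omega
  · intro k
    exact h _ (by omega)

/-- Krattenthaler's determinant. -/
theorem sectionDet_krattPoly (n : ℕ) (x y : ℚ) :
    sectionDet n (krattPoly x y) = ∏ i ∈ range n, krattPolyFactor x y i := by
  have hx : ∀ (x : ℚ) (y : ℕ), n ≤ y →
      sectionDet n (krattPoly x (y : ℚ)) = ∏ i ∈ range n, krattPolyFactor x (y : ℚ) i := by
    intro x y hy
    have h : sectionDet n (krattPoly Polynomial.X (Polynomial.C (y : ℚ))) =
        ∏ i ∈ range n, krattPolyFactor Polynomial.X (Polynomial.C (y : ℚ)) i := by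
      refine polynomial_eq_of_eval_natCast n fun k hk => ?_
      simp only [← Polynomial.coe_evalRingHom, map_sectionDet_krattPoly, map_prod,
        map_krattPolyFactor]
      simpa using sectionDet_krattPoly_natCast hk hy
    have h' := congrArg (Polynomial.evalRingHom x) h
    simpa only [map_sectionDet_krattPoly, map_prod, map_krattPolyFactor,
      Polynomial.coe_evalRingHom, Polynomial.eval_X, Polynomial.eval_C] using h'
  have h : sectionDet n (krattPoly (Polynomial.C x) Polynomial.X) =
      ∏ i ∈ range n, krattPolyFactor (Polynomial.C x) Polynomial.X i := by
    refine polynomial_eq_of_eval_natCast n fun k hk => ?_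
    simp only [← Polynomial.coe_evalRingHom, map_sectionDet_krattPoly, map_prod,
      map_krattPolyFactor]
    simpa using hx x k hk
  have h' := congrArg (Polynomial.evalRingHom y) h
  simpa only [map_sectionDet_krattPoly, map_prod, map_krattPolyFactor,
    Polynomial.coe_evalRingHom, Polynomial.eval_X, Polynomial.eval_C] using h'

end Krattenthaler

section Fibonacci

variable {R : Type*} [CommRing R] (z q : R)

/-- The bivariate Fibonacci polynomial. -/
def fibSum (r : ℕ) : R := ∑ b ∈ range (r + 1), ((r - b).choose b : R) * z ^ (r - 2 * b) * q ^ b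

theorem fibSum_eq_sum_range {r K : ℕ} (h : r < 2 * K) :
    fibSum z q r = ∑ b ∈ range K, ((r - b).choose b : R) * z ^ (r - 2 * b) * q ^ b := by
  have hz : ∀ b, r < 2 * b → ((r - b).choose b : R) * z ^ (r - 2 * b) * q ^ b = 0 := by
    intro b hb
    rw [Nat.choose_eq_zero_of_lt (by omega)]
    simp
  rcases le_total K (r + 1) with hK | hK
  · refine (sum_subset (range_subset_range.2 hK) fun b _ hb => hz b ?_).symm
    simp at hb; omega
  · refine sum_subset (range_subset_range.2 hK) fun b _ hb => hz b ?_
    simp at hb; omega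

theorem mul_fibSum_eq_sum_range {r K : ℕ} (h : r + 2 < 2 * K) :
    q * fibSum z q r = ∑ b ∈ range K,
      (if b = 0 then 0 else ((r + 1 - b).choose (b - 1) : R)) * z ^ (r + 2 - 2 * b) * q ^ b := by
  obtain ⟨K, rfl⟩ : ∃ L, K = L + 1 := ⟨K - 1, by omega⟩
  rw [sum_range_succ', fibSum_eq_sum_range z q (K := K) (by omega), mul_sum]
  simp only [if_true, zero_mul, add_zero]
  refine sum_congr rfl fun b _ => ?_
  rw [if_neg (by omega), show r + 1 - (b + 1) = r - b by omega, show b + 1 - 1 = b by omega,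
    show r + 2 - 2 * (b + 1) = r - 2 * b by omega]
  ring

theorem fibSum_add_two (r : ℕ) :
    fibSum z q (r + 2) = z * fibSum z q (r + 1) + q * fibSum z q r := by
  rw [fibSum, sum_range_succ' _ (r + 2),
    fibSum_eq_sum_range z q (r := r + 1) (K := r + 2 + 1) (by omega),
    sum_range_succ' _ (r + 2), fibSum_eq_sum_range z q (r := r) (K := r + 2) (by omega), mul_add,
    mul_sum, mul_sum, add_right_comm, ← sum_add_distrib]
  congr 1
  · refine sum_congr rfl fun b hb => ?_
    rw [show r + 1 - (b + 1) = r - b by omega, show r + 2 - 2 * (b + 1) = r - 2 * b by omega]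
    rcases le_or_gt b r with h | h
    · rw [show r + 2 - (b + 1) = r - b + 1 by omega, Nat.choose_succ_succ]
      rcases le_or_gt (2 * b + 1) r with h' | h'
      · rw [show r - 2 * b = r + 1 - 2 * (b + 1) + 1 by omega]
        push_cast; ring
      · rw [Nat.choose_eq_zero_of_lt (show r - b < b + 1 by omega)]
        push_cast; ring
    · simp at hb
      obtain rfl : b = r + 1 := by omega
      simp
  · simp; ring

theorem fibSum_zero : fibSum z q 0 = 1 := by simp [fibSum]

theorem fibSum_one : fibSum z q 1 = z := by simp [fibSum, sum_range_succ]

theorem one_sub_mul_fibSum (β : R) (r : ℕ) :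
    (1 - β) * fibSum (1 + β) (-β) r = 1 - β ^ (r + 1) := by
  induction r using Nat.twoStepInduction with
  | zero => simp [fibSum_zero]
  | one => rw [fibSum_one]; ring
  | more r h1 h2 =>
    rw [fibSum_add_two]
    linear_combination (1 + β) * h2 - β * h1

theorem fibSum_add_mul_fibSum (β : R) (r : ℕ) :
    fibSum (1 + β) (-β) (r + 2) + -β * fibSum (1 + β) (-β) r = 1 + β ^ (r + 2) := by
  induction r using Nat.twoStepInduction with
  | zero => rw [fibSum_add_two, fibSum_one, fibSum_zero]; ring
  | one => rw [fibSum_add_two, fibSum_add_two, fibSum_one, fibSum_zero]; ring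
  | more r h1 h2 =>
    rw [fibSum_add_two _ _ (r + 2), fibSum_add_two _ _ r, ← fibSum_add_two _ _ r]
    rw [fibSum_add_two _ _ (r + 1)] at h2 ⊢
    rw [fibSum_add_two _ _ r] at *
    linear_combination (1 + β) * h2 - β * h1

end Fibonacci

section Coefficients

/-- The coefficient of `z ^ (s - 2 * b) * q ^ b` in
`a * fibSum z q s + c * q * fibSum z q (s - 2)`. -/
def fibCombCoeff (a c : ℚ) (s b : ℕ) : ℚ :=
  a * (s - b).choose b + c * if b = 0 then 0 else ((s - 1 - b).choose (b - 1) : ℚ)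

/-- Coordinates of the image of `X ^ j * (X - 1) ^ j` in the eigenbasis of the second
involution. -/
def evenCoeff (m i j : ℕ) : ℚ :=
  if i ≤ 2 * j + m then fibCombCoeff 1 1 (3 * j + 2 * m) (2 * j + m - i) else 0

/-- Coordinates of the image of `(2 * X - 1) * X ^ j * (X - 1) ^ j` in the eigenbasis of the second
involution. -/
def oddCoeff (m i j : ℕ) : ℚ :=
  if i ≤ 2 * j + m then fibCombCoeff 2 (-1) (3 * j + 2 * m + 1) (2 * j + m - i) else 0

theorem fibCombCoeff_eq_zero {a c : ℚ} {s b : ℕ} (hs : 2 ≤ s) (h : s < 2 * b) :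
    fibCombCoeff a c s b = 0 := by
  rw [fibCombCoeff, Nat.choose_eq_zero_of_lt (by omega)]
  split_ifs
  · simp
  · rw [Nat.choose_eq_zero_of_lt (by omega)]; simp

theorem fibCombCoeff_eq {a c : ℚ} {s b : ℕ} (h : 2 * b ≤ s) (hs : 0 < s) :
    fibCombCoeff a c s b = (a * (s - b : ℕ) + c * b) *
      ((s - b - 1).factorial / ((s - 2 * b).factorial * b.factorial)) := by
  obtain ⟨d, rfl⟩ : ∃ d, s = 2 * b + d := ⟨s - 2 * b, by omega⟩
  rw [fibCombCoeff, show 2 * b + d - b = b + d by omega, show 2 * b + d - 2 * b = d by omega,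
    Nat.cast_add_choose]
  rcases b with _ | b
  · obtain ⟨d, rfl⟩ : ∃ e, d = e + 1 := ⟨d - 1, by omega⟩
    simp [Nat.factorial_succ]
    field_simp
  · rw [if_neg (by omega), show 2 * (b + 1) + d - 1 - (b + 1) = b + d by omega,
      show b + 1 - 1 = b by omega, Nat.cast_add_choose, show b + 1 + d - 1 = b + d by omega,
      show b + 1 + d = b + d + 1 by omega, Nat.factorial_succ, Nat.factorial_succ]
    push_cast
    field_simp

theorem sum_fibCombCoeff {R : Type*} [CommRing R] [Algebra ℚ R] (z q : R) (a c : ℚ) {r K : ℕ}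
    (h : r + 2 < 2 * K) :
    algebraMap ℚ R a * fibSum z q (r + 2) + algebraMap ℚ R c * (q * fibSum z q r) =
      ∑ b ∈ range K,
        algebraMap ℚ R (fibCombCoeff a c (r + 2) b) * z ^ (r + 2 - 2 * b) * q ^ b := by
  rw [mul_fibSum_eq_sum_range z q h, fibSum_eq_sum_range z q h, mul_sum, mul_sum,
    ← sum_add_distrib]
  refine sum_congr rfl fun b _ => ?_
  rw [fibCombCoeff, show r + 2 - 1 - b = r + 1 - b by omega]
  split_ifs <;> simp <;> ring

end Coefficients

section Series

open PowerSeries in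
theorem invOneSub_mul_one_sub : (PowerSeries.mk 1 : ℚ⟦X⟧) * (1 - X) = 1 :=
  PowerSeries.mk_one_mul_one_sub_eq_one ℚ

open PowerSeries in
theorem one_sub_pow_mul_invOneSub_pow {b k : ℕ} (h : b ≤ k) :
    (1 - X : ℚ⟦X⟧) ^ b * (PowerSeries.mk 1) ^ k = (PowerSeries.mk 1) ^ (k - b) := by
  obtain ⟨d, rfl⟩ := Nat.exists_eq_add_of_le h
  rw [pow_add, ← mul_assoc, ← mul_pow, mul_comm (1 - X), invOneSub_mul_one_sub,
    Nat.add_sub_cancel_left]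
  simp

open PowerSeries in
theorem even_image_eq_sum (m j : ℕ) (hm : 0 < m) :
    (X ^ j * (X - 1) ^ j + X ^ j * (PowerSeries.mk 1) ^ (2 * m + 2 * j) : ℚ⟦X⟧) =
      ∑ i ∈ range (2 * j + m + 1),
        algebraMap ℚ ℚ⟦X⟧ (evenCoeff m i j) * (X ^ (2 * i) * (PowerSeries.mk 1) ^ (m + i)) := by
  obtain ⟨r, hr⟩ : ∃ r, 3 * j + 2 * m = r + 2 := ⟨3 * j + 2 * m - 2, by omega⟩
  have h1 := fibSum_add_mul_fibSum (X - 1 : ℚ⟦X⟧) r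
  have h2 := sum_fibCombCoeff (X : ℚ⟦X⟧) (1 - X) 1 1 (r := r) (K := 2 * j + m + 1) (by omega)
  rw [show (1 + (X - 1) : ℚ⟦X⟧) = X by ring, show -(X - 1 : ℚ⟦X⟧) = 1 - X by ring] at h1
  rw [map_one, one_mul, one_mul, h1] at h2
  have h3 : (X ^ j * (X - 1) ^ j + X ^ j * (PowerSeries.mk 1) ^ (2 * m + 2 * j) : ℚ⟦X⟧) =
      X ^ j * (PowerSeries.mk 1) ^ (2 * m + 2 * j) * (1 + (X - 1) ^ (r + 2)) := by
    have h4 := one_sub_pow_mul_invOneSub_pow (le_refl (2 * m + 2 * j))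
    rw [Nat.sub_self, pow_zero] at h4
    rw [← hr, show 3 * j + 2 * m = (2 * m + 2 * j) + j by ring, pow_add _ (2 * m + 2 * j) j,
      show (X - 1 : ℚ⟦X⟧) ^ (2 * m + 2 * j) = (1 - X) ^ (2 * m + 2 * j) by
        rw [← mul_add, pow_mul, pow_mul]; congr 1; ring]
    linear_combination (-X ^ j * (X - 1) ^ j) * h4
  rw [h3, h2, mul_sum, ← sum_range_reflect]
  refine sum_congr rfl fun i hi => ?_
  rw [mem_range] at hi
  rw [evenCoeff, if_pos (by omega), hr, show 2 * j + m + 1 - 1 - i = 2 * j + m - i by omega]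
  rcases le_or_gt (2 * (2 * j + m - i)) (r + 2) with h | h
  · have h5 := one_sub_pow_mul_invOneSub_pow (b := 2 * j + m - i) (k := 2 * m + 2 * j) (by omega)
    rw [show 2 * m + 2 * j - (2 * j + m - i) = m + i by omega] at h5
    rw [← h5, show 2 * i = j + (r + 2 - 2 * (2 * j + m - i)) by omega, pow_add]
    ring
  · rw [fibCombCoeff_eq_zero (by omega) h]
    simp

open PowerSeries in
theorem odd_image_eq_sum (m j : ℕ) (hm : 0 < m) :
    ((2 * X - 1) * X ^ j * (X - 1) ^ j +
        (1 + X) * X ^ j * (PowerSeries.mk 1) ^ (2 * m + 2 * j + 1) : ℚ⟦X⟧) =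
      ∑ i ∈ range (2 * j + m + 1), algebraMap ℚ ℚ⟦X⟧ (oddCoeff m i j) *
        (X ^ (2 * i + 1) * ((PowerSeries.mk 1) ^ (m + i + 1) * (2 - X))) := by
  obtain ⟨r, hr⟩ : ∃ r, 3 * j + 2 * m + 1 = r + 2 := ⟨3 * j + 2 * m - 1, by omega⟩
  have h1 := one_sub_mul_fibSum (X - 1 : ℚ⟦X⟧) (r + 2)
  have h1' := one_sub_mul_fibSum (X - 1 : ℚ⟦X⟧) r
  have h2 := sum_fibCombCoeff (X : ℚ⟦X⟧) (1 - X) 2 (-1) (r := r) (K := 2 * j + m + 1) (by omega)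
  rw [show (1 + (X - 1) : ℚ⟦X⟧) = X by ring, show -(X - 1 : ℚ⟦X⟧) = 1 - X by ring] at h1 h1'
  rw [map_neg, map_one, map_ofNat] at h2
  have h3 : ((2 * X - 1) * X ^ j * (X - 1) ^ j +
        (1 + X) * X ^ j * (PowerSeries.mk 1) ^ (2 * m + 2 * j + 1) : ℚ⟦X⟧) =
      X ^ j * (PowerSeries.mk 1) ^ (2 * m + 2 * j + 1) * (2 - X) *
        (2 * fibSum X (1 - X) (r + 2) + -1 * ((1 - X) * fibSum X (1 - X) r)) := by
    have h4 := one_sub_pow_mul_invOneSub_pow (le_refl (2 * m + 2 * j + 1))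
    rw [Nat.sub_self, pow_zero] at h4
    have h6 : (X - 1 : ℚ⟦X⟧) ^ (r + 2) = -(1 - X) ^ (2 * m + 2 * j + 1) * (X - 1) ^ j := by
      rw [← hr, show 3 * j + 2 * m + 1 = (2 * m + 2 * j + 1) + j by ring,
        pow_add _ (2 * m + 2 * j + 1) j,
        ← neg_sub X 1, Odd.neg_pow ⟨m + j, by ring⟩]
      ring
    have h7 : (2 - X) * (2 * fibSum X (1 - X) (r + 2) + -1 * ((1 - X) * fibSum X (1 - X) r)) =
        (1 + X : ℚ⟦X⟧) - (2 * X - 1) * (X - 1) ^ (r + 2) := by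
      linear_combination 2 * h1 - (1 - X) * h1'
    rw [mul_assoc _ (2 - X), h7, h6]
    linear_combination (-(2 * X - 1) * X ^ j * (X - 1) ^ j) * h4
  rw [h3, h2, mul_sum, ← sum_range_reflect]
  refine sum_congr rfl fun i hi => ?_
  rw [mem_range] at hi
  rw [oddCoeff, if_pos (by omega), hr, show 2 * j + m + 1 - 1 - i = 2 * j + m - i by omega]
  rcases le_or_gt (2 * (2 * j + m - i)) (r + 2) with h | h
  · have h5 := one_sub_pow_mul_invOneSub_pow (b := 2 * j + m - i) (k := 2 * m + 2 * j + 1)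
      (by omega)
    rw [show 2 * m + 2 * j + 1 - (2 * j + m - i) = m + i + 1 by omega] at h5
    rw [← h5, show 2 * i + 1 = j + (r + 2 - 2 * (2 * j + m - i)) by omega, pow_add]
    ring
  · rw [fibCombCoeff_eq_zero (by omega) h]
    simp

end Series

section Factorization

open Polynomial in
/-- Eigenvectors of `p ↦ p (1 - X)`. -/
noncomputable def reflPoly (c : ℕ) : ℚ[X] := (2 * X - 1) ^ (c % 2) * (X * (X - 1)) ^ (c / 2)

open PowerSeries in
/-- Truncations of these series are eigenvectors of the involution dual to `p ↦ p (1 - X)`. -/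
noncomputable def dualSeries (m c : ℕ) : ℚ⟦X⟧ :=
  X ^ c * ((PowerSeries.mk 1) ^ (m + (c + 1) / 2) * (2 - X) ^ (c % 2))

open Polynomial in
theorem natDegree_two_mul_X_sub_one_le : (2 * X - 1 : ℚ[X]).natDegree ≤ 1 := by
  compute_degree

open Polynomial in
theorem natDegree_X_mul_X_sub_one_le : (X * (X - 1) : ℚ[X]).natDegree ≤ 2 := by
  compute_degree

open Polynomial in
theorem natDegree_reflPoly_le (c : ℕ) : (reflPoly c).natDegree ≤ c := by
  have h1 := natDegree_pow_le_of_le (c % 2) natDegree_two_mul_X_sub_one_le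
  have h2 := natDegree_pow_le_of_le (c / 2) natDegree_X_mul_X_sub_one_le
  exact (natDegree_mul_le_of_le h1 h2).trans (by omega)

open Polynomial in
theorem coeff_reflPoly_self (c : ℕ) : (reflPoly c).coeff c = 2 ^ (c % 2) := by
  have h1 := natDegree_pow_le_of_le (c % 2) natDegree_two_mul_X_sub_one_le
  have h2 := natDegree_pow_le_of_le (c / 2) natDegree_X_mul_X_sub_one_le
  have h3 := coeff_mul_add_eq_of_natDegree_le h1 h2
  rw [coeff_pow_of_natDegree_le natDegree_two_mul_X_sub_one_le,
    coeff_pow_of_natDegree_le natDegree_X_mul_X_sub_one_le,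
    show c % 2 * 1 + c / 2 * 2 = c by omega] at h3
  rw [reflPoly, h3]
  have e1 : (2 * X - 1 : ℚ[X]).coeff 1 = 2 := by
    rw [show (2 * X - 1 : ℚ[X]) = Polynomial.C 2 * X - Polynomial.C 1 by
      rw [map_ofNat, map_one], coeff_sub, coeff_C_mul,
      coeff_X_one, coeff_C_of_ne_zero one_ne_zero]
    norm_num
  have e2 : (X * (X - 1) : ℚ[X]).coeff 2 = 1 := by
    rw [coeff_X_mul, coeff_sub, coeff_X_one, coeff_one]
    norm_num
  rw [e1, e2]
  simp

open PowerSeries in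
theorem coe_reflPoly (c : ℕ) :
    (reflPoly c : ℚ⟦X⟧) = (2 * X - 1) ^ (c % 2) * (X * (X - 1)) ^ (c / 2) := by
  rw [reflPoly, Polynomial.coe_mul, Polynomial.coe_pow, Polynomial.coe_pow, Polynomial.coe_mul,
    Polynomial.coe_sub, Polynomial.coe_sub, two_mul, Polynomial.coe_add, Polynomial.coe_X,
    Polynomial.coe_one, two_mul]

open PowerSeries in
theorem aeval_invOneSub_reflPoly (c : ℕ) :
    Polynomial.aeval (PowerSeries.mk 1 : ℚ⟦X⟧) (reflPoly c) =
      ((1 + X) * PowerSeries.mk 1) ^ (c % 2) * (X * PowerSeries.mk 1 ^ 2) ^ (c / 2) := by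
  have hv := invOneSub_mul_one_sub
  have h2 : (PowerSeries.mk 1 : ℚ⟦X⟧) * (PowerSeries.mk 1 - 1) = X * PowerSeries.mk 1 ^ 2 := by
    linear_combination (PowerSeries.mk 1 : ℚ⟦X⟧) * hv
  have h3 : (2 * PowerSeries.mk 1 - 1 : ℚ⟦X⟧) = (1 + X) * PowerSeries.mk 1 := by
    linear_combination hv
  simp only [reflPoly, map_mul, map_pow, map_sub, map_one, map_ofNat, Polynomial.aeval_X, h2, h3]

theorem coeff_dualSeries_of_lt {m c l : ℕ} (h : l < c) :
    PowerSeries.coeff l (dualSeries m c) = 0 := by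
  rw [dualSeries, PowerSeries.coeff_X_pow_mul', if_neg (by omega)]

theorem coeff_dualSeries_self (m c : ℕ) :
    PowerSeries.coeff c (dualSeries m c) = 2 ^ (c % 2) := by
  rw [dualSeries, PowerSeries.coeff_X_pow_mul', if_pos le_rfl, Nat.sub_self,
    PowerSeries.coeff_zero_eq_constantCoeff_apply, map_mul, map_pow, map_pow, map_sub, map_ofNat,
    PowerSeries.constantCoeff_X, ← PowerSeries.coeff_zero_eq_constantCoeff_apply,
    PowerSeries.coeff_mk]
  simp

theorem det_reflPoly (N : ℕ) :
    Matrix.det (Matrix.of fun l c : Fin N => (reflPoly c).coeff l) =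
      ∏ c : Fin N, (2 : ℚ) ^ ((c : ℕ) % 2) := by
  rw [Matrix.det_of_isUpperTriangular]
  · simp [coeff_reflPoly_self]
  · intro i j h
    exact Polynomial.coeff_eq_zero_of_natDegree_lt ((natDegree_reflPoly_le _).trans_lt h)

theorem det_dualSeries (m N : ℕ) :
    Matrix.det (Matrix.of fun l c : Fin N => PowerSeries.coeff (l : ℕ) (dualSeries m c)) =
      ∏ c : Fin N, (2 : ℚ) ^ ((c : ℕ) % 2) := by
  rw [Matrix.det_of_isLowerTriangular]
  · simp [coeff_dualSeries_self]
  · intro i j h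
    exact coeff_dualSeries_of_lt h

/-- The matrix of the sum of the two involutions in the bases `reflPoly`, `dualSeries`. -/
def parityCoeff (m c' c : ℕ) : ℚ :=
  if c' % 2 = c % 2 then
    if c % 2 = 0 then evenCoeff m (c' / 2) (c / 2) else oddCoeff m (c' / 2) (c / 2)
  else 0

def evenOddEquiv (n : ℕ) : Fin n ⊕ Fin (n - 1) ≃ Fin (2 * n - 1) where
  toFun := Sum.elim (fun i => ⟨2 * i, by omega⟩) fun i => ⟨2 * i + 1, by omega⟩
  invFun c := if h : (c : ℕ) % 2 = 0 then Sum.inl ⟨c / 2, by omega⟩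
    else Sum.inr ⟨c / 2, by omega⟩
  left_inv := by
    rintro (i | i)
    · simp
    · have : (2 * (i : ℕ) + 1) / 2 = i := by omega
      simp [Nat.add_mod, this]
  right_inv c := by
    by_cases h : (c : ℕ) % 2 = 0
    · simp only [h, dite_true, Sum.elim_inl, Fin.ext_iff]; omega
    · simp only [h, dite_false, Sum.elim_inr, Fin.ext_iff]; omega

@[simp]
theorem evenOddEquiv_inl (n : ℕ) (i : Fin n) : (evenOddEquiv n (Sum.inl i) : ℕ) = 2 * i := rfl

@[simp]
theorem evenOddEquiv_inr (n : ℕ) (i : Fin (n - 1)) :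
    (evenOddEquiv n (Sum.inr i) : ℕ) = 2 * i + 1 := rfl

theorem parityCoeff_even_even (m i j : ℕ) : parityCoeff m (2 * i) (2 * j) = evenCoeff m i j := by
  simp [parityCoeff]

theorem parityCoeff_odd_odd (m i j : ℕ) :
    parityCoeff m (2 * i + 1) (2 * j + 1) = oddCoeff m i j := by
  rw [parityCoeff, if_pos (by omega), if_neg (by omega), show (2 * i + 1) / 2 = i by omega,
    show (2 * j + 1) / 2 = j by omega]

theorem parityCoeff_even_odd (m i j : ℕ) : parityCoeff m (2 * i) (2 * j + 1) = 0 :=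
  if_neg (by omega)

theorem parityCoeff_odd_even (m i j : ℕ) : parityCoeff m (2 * i + 1) (2 * j) = 0 :=
  if_neg (by omega)

theorem det_parityCoeff (m n : ℕ) :
    Matrix.det (Matrix.of fun c' c : Fin (2 * n - 1) => parityCoeff m c' c) =
      sectionDet n (evenCoeff m) * sectionDet (n - 1) (oddCoeff m) := by
  rw [← Matrix.det_submatrix_equiv_self (evenOddEquiv n), sectionDet, sectionDet,
    ← Matrix.det_fromBlocks_zero₂₁ _ 0]
  congr 1
  ext (i | i) (j | j)
  · exact parityCoeff_even_even m i j
  · exact parityCoeff_even_odd m i j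
  · exact parityCoeff_odd_even m i j
  · exact parityCoeff_odd_odd m i j

theorem sum_range_eq_sum_range {M : Type*} [AddCommMonoid M] {u : ℕ → M} {a b : ℕ}
    (ha : ∀ i ≥ a, u i = 0) (hb : ∀ i ≥ b, u i = 0) :
    ∑ i ∈ range a, u i = ∑ i ∈ range b, u i := by
  rcases le_total a b with h | h
  · exact (eventually_constant_sum ha h).symm
  · exact eventually_constant_sum hb h

theorem sum_dualSeries_mul_parityCoeff {m n l c : ℕ} (hl : l < 2 * n - 1) (hm : 0 < m) :
    ∑ c' : Fin (2 * n - 1), PowerSeries.coeff l (dualSeries m c') * parityCoeff m c' c =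
      PowerSeries.coeff l ((reflPoly c : PowerSeries ℚ) +
        PowerSeries.mk 1 ^ (2 * m) * Polynomial.aeval (PowerSeries.mk 1) (reflPoly c)) := by
  rw [← (evenOddEquiv n).sum_comp, Fintype.sum_sum_type]
  simp only [evenOddEquiv_inl, evenOddEquiv_inr]
  rw [Fin.sum_univ_eq_sum_range (fun i => PowerSeries.coeff l (dualSeries m (2 * i)) *
      parityCoeff m (2 * i) c) n,
    Fin.sum_univ_eq_sum_range (fun i => PowerSeries.coeff l (dualSeries m (2 * i + 1)) *
      parityCoeff m (2 * i + 1) c) (n - 1)]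
  obtain ⟨j, rfl | rfl⟩ := Nat.even_or_odd' c
  · have h := even_image_eq_sum m j hm
    have hp : (reflPoly (2 * j) : PowerSeries ℚ) + PowerSeries.mk 1 ^ (2 * m) *
          Polynomial.aeval (PowerSeries.mk 1) (reflPoly (2 * j)) =
        PowerSeries.X ^ j * (PowerSeries.X - 1) ^ j +
          PowerSeries.X ^ j * PowerSeries.mk 1 ^ (2 * m + 2 * j) := by
      rw [coe_reflPoly, aeval_invOneSub_reflPoly, Nat.mul_mod_right,
        Nat.mul_div_cancel_left _ (by norm_num), ← mul_pow]
      ring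
    simp only [parityCoeff_even_even, parityCoeff_odd_even, mul_zero, sum_const_zero, add_zero]
    rw [hp, h, map_sum, sum_range_eq_sum_range (b := 2 * j + m + 1)]
    · refine sum_congr rfl fun i _ => ?_
      rw [dualSeries, Nat.mul_mod_right, show (2 * i + 1) / 2 = i by omega, pow_zero, mul_one,
        ← Algebra.smul_def, PowerSeries.coeff_smul, mul_comm]
      simp
    · intro i hi
      rw [coeff_dualSeries_of_lt (by omega), zero_mul]
    · intro i hi
      rw [evenCoeff, if_neg (by omega), mul_zero]
  · have h := odd_image_eq_sum m j hm
    have hp : (reflPoly (2 * j + 1) : PowerSeries ℚ) + PowerSeries.mk 1 ^ (2 * m) *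
          Polynomial.aeval (PowerSeries.mk 1) (reflPoly (2 * j + 1)) =
        (2 * PowerSeries.X - 1) * PowerSeries.X ^ j * (PowerSeries.X - 1) ^ j +
          (1 + PowerSeries.X) * PowerSeries.X ^ j * PowerSeries.mk 1 ^ (2 * m + 2 * j + 1) := by
      rw [coe_reflPoly, aeval_invOneSub_reflPoly, show (2 * j + 1) % 2 = 1 by omega,
        show (2 * j + 1) / 2 = j by omega, mul_assoc (2 * PowerSeries.X - 1), ← mul_pow]
      ring
    simp only [parityCoeff_odd_odd, parityCoeff_even_odd, mul_zero, sum_const_zero, zero_add]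
    rw [hp, h, map_sum, sum_range_eq_sum_range (b := 2 * j + m + 1)]
    · refine sum_congr rfl fun i _ => ?_
      rw [dualSeries, show (2 * i + 1) % 2 = 1 by omega, show (2 * i + 1 + 1) / 2 = i + 1 by omega,
        pow_one, ← add_assoc, ← Algebra.smul_def, PowerSeries.coeff_smul, mul_comm]
      simp
    · intro i hi
      rw [coeff_dualSeries_of_lt (by omega), zero_mul]
    · intro i hi
      rw [oddCoeff, if_neg (by omega), mul_zero]

theorem det_one_add_eq_mul_sectionDet (n m : ℕ) (hm : 0 < m) :
    Matrix.det (1 + Matrix.of fun i j : Fin (2 * n - 1) =>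
        PowerSeries.coeff (i : ℕ) (PowerSeries.mk 1 ^ (2 * m + j) : PowerSeries ℚ)) =
      sectionDet n (evenCoeff m) * sectionDet (n - 1) (oddCoeff m) := by
  have hE := det_reflPoly (2 * n - 1)
  have hF := det_dualSeries m (2 * n - 1)
  rw [← det_parityCoeff]
  have hpos : (∏ c : Fin (2 * n - 1), (2 : ℚ) ^ ((c : ℕ) % 2)) ≠ 0 :=
    prod_ne_zero_iff.2 fun c _ => by positivity
  refine mul_right_cancel₀ hpos ?_
  rw [← hE, ← Matrix.det_mul, hE, ← hF, mul_comm (Matrix.det _), ← Matrix.det_mul]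
  congr 1
  ext l c
  rw [Matrix.add_mul, Matrix.one_mul, Matrix.add_apply, Matrix.mul_apply, Matrix.mul_apply]
  simp only [Matrix.of_apply]
  rw [sum_dualSeries_mul_parityCoeff l.isLt hm, map_add, Polynomial.coeff_coe,
    Polynomial.aeval_eq_sum_range' (n := 2 * n - 1)
      ((natDegree_reflPoly_le _).trans_lt c.isLt), mul_sum, map_sum,
    ← Fin.sum_univ_eq_sum_range (fun i => PowerSeries.coeff (l : ℕ) (PowerSeries.mk 1 ^ (2 * m) *
      (reflPoly c).coeff i • (PowerSeries.mk 1 : PowerSeries ℚ) ^ i)) (2 * n - 1)]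
  congr 1
  refine sum_congr rfl fun i _ => ?_
  rw [mul_smul_comm, PowerSeries.coeff_smul, pow_add, smul_eq_mul, mul_comm]

end Factorization

section Evaluation

theorem krattPoly_eq_zero_of_lt_left {x y i j : ℕ} (h : x + 2 * i < j) :
    krattPoly (x : ℚ) y i j = 0 := by
  have : ∏ k ∈ range j, ((x : ℚ) + 2 * i - k) = 0 :=
    prod_eq_zero (mem_range.2 h) (by push_cast; ring)
  rw [krattPoly, this, mul_zero, zero_mul]

theorem krattPoly_eq_zero_of_lt_right {x y i j : ℕ} (h : y + 2 * j < i) :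
    krattPoly (x : ℚ) y i j = 0 := by
  have : ∏ k ∈ range i, ((y : ℚ) + 2 * j - k) = 0 :=
    prod_eq_zero (mem_range.2 h) (by push_cast; ring)
  rw [krattPoly, this, mul_zero]

theorem evenCoeff_eq {m : ℕ} (hm : 0 < m) (i j : ℕ) :
    evenCoeff m i j = (1 / (2 * i).factorial) *
      (((3 * j + 2 * m) * (m + j - 1).factorial / (m + 2 * j).factorial) *
        krattPoly ((0 : ℕ) : ℚ) m i j) := by
  rw [evenCoeff]
  split_ifs with h
  · rcases le_or_gt j (2 * i) with h' | h'
    · rw [fibCombCoeff_eq (by omega) (by omega),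
        krattPoly_natCast (by omega) (by omega) (by omega), krattEntry,
        show 3 * j + 2 * m - (2 * j + m - i) - 1 = 0 + m + i + j - 1 by omega,
        show 3 * j + 2 * m - 2 * (2 * j + m - i) = 0 + 2 * i - j by omega,
        show 2 * j + m - i = m + 2 * j - i by omega,
        show 3 * j + 2 * m - (m + 2 * j - i) = j + m + i by omega,
        show 0 + m + j - 1 = m + j - 1 by omega, zero_add (2 * i), Nat.cast_sub (by omega)]
      push_cast
      field_simp
      ring
    · rw [fibCombCoeff_eq_zero (by omega) (by omega), krattPoly_eq_zero_of_lt_left (by omega)]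
      ring
  · rw [krattPoly_eq_zero_of_lt_right (by omega)]
    ring

theorem oddCoeff_eq {m : ℕ} (hm : 0 < m) (i j : ℕ) :
    oddCoeff m i j = ((3 * i + m + 2) / (2 * i + 1).factorial) *
      (((m + j).factorial / (m + 2 * j).factorial) * krattPoly ((1 : ℕ) : ℚ) m i j) := by
  rw [oddCoeff]
  split_ifs with h
  · rcases le_or_gt j (2 * i + 1) with h' | h'
    · rw [fibCombCoeff_eq (by omega) (by omega),
        krattPoly_natCast (by omega) (by omega) (by omega), krattEntry,
        show 3 * j + 2 * m + 1 - (2 * j + m - i) - 1 = 1 + m + i + j - 1 by omega,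
        show 3 * j + 2 * m + 1 - 2 * (2 * j + m - i) = 1 + 2 * i - j by omega,
        show 2 * j + m - i = m + 2 * j - i by omega,
        show 3 * j + 2 * m + 1 - (m + 2 * j - i) = j + m + i + 1 by omega,
        show 1 + m + j - 1 = m + j by omega, add_comm 1 (2 * i), Nat.cast_sub (by omega)]
      push_cast
      field_simp
      ring
    · rw [fibCombCoeff_eq_zero (by omega) (by omega), krattPoly_eq_zero_of_lt_left (by omega)]
      ring
  · rw [krattPoly_eq_zero_of_lt_right (by omega)]
    ring

/-- Consecutive quotients of `fun n => sectionDet n (evenCoeff m)`. -/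
def evenFactor (m i : ℕ) : ℚ :=
  (3 * i + 2 * m) * ((m + i - 1).factorial / ((2 * i).factorial * (m + 2 * i).factorial)) *
    (i.factorial * asc (m + 2 * i) i * asc (2 * m + 2 * i) i)

/-- Consecutive quotients of `fun n => sectionDet n (oddCoeff m)`. -/
def oddFactor(m i : ℕ) : ℚ :=
  (3 * i + m + 2) * ((m + i).factorial / ((2 * i + 1).factorial * (m + 2 * i).factorial)) *
    (i.factorial * asc (m + 2 + 2 * i) i * asc (2 * m + 1 + 2 * i) i)

theorem sectionDet_evenCoeff (n : ℕ) {m : ℕ} (hm : 0 < m) :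
    sectionDet n (evenCoeff m) = ∏ i ∈ range n, evenFactor m i := by
  rw [show evenCoeff m = _ from funext₂ (evenCoeff_eq hm), sectionDet_mul_row_mul_column,
    sectionDet_krattPoly, ← prod_mul_distrib, ← prod_mul_distrib]
  refine prod_congr rfl fun i _ => ?_
  rw [evenFactor, krattPolyFactor, asc, asc]
  push_cast
  simp only [mul_zero, zero_add]
  field_simp

theorem sectionDet_oddCoeff (n : ℕ) {m : ℕ} (hm : 0 < m) :
    sectionDet n (oddCoeff m) = ∏ i ∈ range n, oddFactor m i := by
  rw [show oddCoeff m = _ from funext₂ (oddCoeff_eq hm), sectionDet_mul_row_mul_column,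
    sectionDet_krattPoly, ← prod_mul_distrib, ← prod_mul_distrib]
  refine prod_congr rfl fun i _ => ?_
  rw [oddFactor, krattPolyFactor, asc, asc,
    show (2 * ((1 : ℕ) : ℚ) + m + 2 * i) = (m + 2 + 2 * i : ℕ) by
    push_cast; ring, show (((1 : ℕ) : ℚ) + 2 * m + 2 * i) = (2 * m + 1 + 2 * i : ℕ) by
    push_cast; ring]
  field_simp

end Evaluation

section ClosedForm

theorem asc_succ_eq (a k : ℕ) : asc (a + 1) k = (a + k).factorial / a.factorial := by
  rw [← factorial_mul_asc]
  field_simp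

def tilingFactor (x i : ℕ) : ℚ :=
  (i.factorial : ℚ) ^ 2 * (asc (2 * x + 2 * i) i) ^ 2 * ((x + i).factorial : ℚ) *
    asc (x + 2 * i) (i + 1) * asc (x + 2 * i + 1) i / ((2 * i).factorial : ℚ) ^ 2

theorem prod_factorial_add_succ (x n : ℕ) :
    ((x + n).factorial : ℚ) * ∏ i ∈ range (n + 1), ((x + (n + 1) + i).factorial : ℚ) =
      (∏ i ∈ range n, ((x + n + i).factorial : ℚ)) *
        ((x + 2 * n).factorial * (x + 2 * n + 1).factorial) := by
  have h := prod_range_succ' (fun i => ((x + n + i).factorial : ℚ)) (n + 1)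
  rw [prod_range_succ, prod_range_succ, add_zero] at h
  rw [show x + 2 * n = x + n + n by ring, mul_comm, ← mul_assoc, add_assoc _ n 1, h]
  congr 1
  refine prod_congr rfl fun i _ => ?_
  rw [show x + (n + 1) + i = x + n + (i + 1) by ring]

theorem evenFactor_mul_oddFactor (y k : ℕ) :
    evenFactor (y + 2) (k + 1) * oddFactor (y + 2) k * asc (2 * y + 2 * k + 4) (k + 1) *
        (y + k + 2) * ((y + 2 * k + 3).factorial * (y + 2 * k + 4).factorial) =
      asc (2 * y + 2 * k + 6) (k + 2) * tilingFactor (y + 1) (k + 1) * (y + k + 2).factorial := by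
  simp only [evenFactor, oddFactor, tilingFactor]
  rw [show y + 2 + 2 * (k + 1) = y + 2 * k + 3 + 1 by ring,
    show 2 * (y + 2) + 2 * (k + 1) = 2 * y + 2 * k + 5 + 1 by ring,
    show y + 2 + 2 + 2 * k = y + 2 * k + 3 + 1 by ring,
    show 2 * (y + 2) + 1 + 2 * k = 2 * y + 2 * k + 4 + 1 by ring,
    show 2 * y + 2 * k + 4 = 2 * y + 2 * k + 3 + 1 by ring,
    show 2 * y + 2 * k + 6 = 2 * y + 2 * k + 5 + 1 by ring,
    show 2 * (y + 1) + 2 * (k + 1) = 2 * y + 2 * k + 3 + 1 by ring,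
    show y + 1 + 2 * (k + 1) = y + 2 * k + 2 + 1 by ring]
  simp only [asc_succ_eq]
  rw [show y + 2 * k + 3 + (k + 1) = y + 3 * k + 3 + 1 by ring,
    show 2 * y + 2 * k + 5 + (k + 1) = 2 * y + 3 * k + 4 + 1 + 1 by ring,
    show y + 2 * k + 3 + k = y + 3 * k + 3 by ring,
    show 2 * y + 2 * k + 3 + 1 + k = 2 * y + 3 * k + 4 by ring,
    show 2 * y + 2 * k + 3 + (k + 1) = 2 * y + 3 * k + 4 by ring,
    show 2 * y + 2 * k + 5 + (k + 2) = 2 * y + 3 * k + 4 + 1 + 1 + 1 by ring,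
    show y + 2 * k + 2 + (k + 1 + 1) = y + 3 * k + 3 + 1 by ring,
    show y + 2 + (k + 1) - 1 = y + k + 1 + 1 by omega,
    show y + 2 + k = y + k + 1 + 1 by ring,
    show y + 2 + 2 * k = y + 2 * k + 2 by ring,
    show y + 1 + (k + 1) = y + k + 1 + 1 by ring,
    show y + k + 2 = y + k + 1 + 1 by ring,
    show 2 * (k + 1) = 2 * k + 1 + 1 by ring,
    show 2 * y + 2 * k + 5 = 2 * y + 2 * k + 3 + 1 + 1 by ring,
    show y + 2 * k + 4 = y + 2 * k + 2 + 1 + 1 by ring,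
    show y + 2 * k + 3 = y + 2 * k + 2 + 1 by ring]
  simp only [Nat.factorial_succ (y + 3 * k + 3), Nat.factorial_succ (2 * y + 3 * k + 4 + 1 + 1),
    Nat.factorial_succ (2 * y + 3 * k + 4 + 1), Nat.factorial_succ (2 * y + 3 * k + 4),
    Nat.factorial_succ (2 * k + 1), Nat.factorial_succ (2 * y + 2 * k + 3 + 1),
    Nat.factorial_succ (2 * y + 2 * k + 3), Nat.factorial_succ (y + 2 * k + 2 + 1),
    Nat.factorial_succ (y + 2 * k + 2), Nat.factorial_succ (y + k + 1), Nat.factorial_succ k]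
  push_cast
  field_simp
  ring

theorem prod_evenFactor_mul_prod_oddFactor (n y : ℕ) :
    (∏ i ∈ range (n + 1), evenFactor (y + 2) i) * ∏ i ∈ range n, oddFactor (y + 2) i =
      y.factorial * asc (2 * y + 2 * n + 4) (n + 1) / (y + n + 1).factorial *
        ((∏ i ∈ range (n + 1), tilingFactor (y + 1) i) /
          ∏ i ∈ range (n + 1), ((y + 1 + (n + 1) + i).factorial : ℚ)) := by
  induction n with
  | zero =>
    simp [evenFactor, tilingFactor, asc, Nat.factorial_succ]
    field_simp
    ring
  | succ n ih =>
    have h1 := prod_factorial_add_succ (y + 1) (n + 1)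
    have h2 := evenFactor_mul_oddFactor y n
    have h3 : ((y + n + 2).factorial : ℚ) = (y + n + 2) * (y + n + 1).factorial := by
      rw [Nat.factorial_succ]; push_cast; ring
    have hp : ∀ k, (∏ i ∈ range k, ((y + 1 + k + i).factorial : ℚ)) ≠ 0 := fun k =>
      prod_ne_zero_iff.2 fun i _ => by positivity
    have hq := hp (n + 1)
    have hq' := hp (n + 1 + 1)
    have hf := Nat.cast_ne_zero (R := ℚ).2 (y + n + 1).factorial_ne_zero
    have hf' := Nat.cast_ne_zero (R := ℚ).2 (y + n + 2).factorial_ne_zero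
    have hy : (y + n + 2 : ℚ) ≠ 0 := by positivity
    rw [prod_range_succ (evenFactor _) (n + 1), prod_range_succ (oddFactor _) n,
      mul_mul_mul_comm, ih, prod_range_succ (tilingFactor _) (n + 1),
      show 2 * y + 2 * (n + 1) + 4 = 2 * y + 2 * n + 6 by ring,
      show y + (n + 1) + 1 = y + n + 2 by ring]
    rw [show y + 1 + 2 * (n + 1) = y + 2 * n + 3 by ring,
      show y + 2 * n + 3 + 1 = y + 2 * n + 4 by ring] at h1
    rw [show (y + 1 + (n + 1)).factorial = (y + n + 2).factorial by congr 1; ring] at h1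
    generalize ∏ i ∈ range (n + 1), ((y + 1 + (n + 1) + i).factorial : ℚ) = q at *
    generalize ∏ i ∈ range (n + 1 + 1), ((y + 1 + (n + 1 + 1) + i).factorial : ℚ) = q' at *
    rw [div_mul_div_comm, div_mul_eq_mul_div, div_mul_div_comm,
      div_eq_div_iff (mul_ne_zero hf hq) (mul_ne_zero hf' hq'), h1]
    refine mul_right_cancel₀ hy ?_
    rw [h3] at h2
    linear_combination (y.factorial * (∏ i ∈ range (n + 1), tilingFactor (y + 1) i) * q) * h2

end ClosedForm

theorem CS_odd (n x : ℕ) (hn : 0 < n) (hx : 0 < x) :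
    Matrix.det (fun i j : Fin (2 * n - 1) =>
        (if i = j then (1 : ℚ) else 0) + C (2 * x + 1 + (i : ℕ) + (j : ℕ)) (i : ℤ)) =
      (((x - 1).factorial : ℚ) * asc (2 * x + 2 * n) n / ((x + n - 1).factorial : ℚ)) *
        ∏ i ∈ Finset.range n,
          ((i.factorial : ℚ) ^ 2 * (asc (2 * x + 2 * i) i) ^ 2 *
              ((x + i).factorial : ℚ) * asc (x + 2 * i) (i + 1) * asc (x + 2 * i + 1) i) /
            (((2 * i).factorial : ℚ) ^ 2 * ((x + n + i).factorial : ℚ)) := by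
  obtain ⟨k, rfl⟩ := Nat.exists_eq_add_one.2 hn
  obtain ⟨y, rfl⟩ := Nat.exists_eq_add_one.2 hx
  have hB : Matrix.of (fun i j : Fin (2 * (k + 1) - 1) => (if i = j then (1 : ℚ) else 0) +
      C (2 * (y + 1) + 1 + (i : ℕ) + (j : ℕ)) (i : ℤ)) =
      1 + Matrix.of fun i j : Fin (2 * (k + 1) - 1) => PowerSeries.coeff (i : ℕ)
        (PowerSeries.mk 1 ^ (2 * (y + 2) + j) : PowerSeries ℚ) := by
    ext i j
    rw [Matrix.add_apply, Matrix.one_apply, Matrix.of_apply, Matrix.of_apply, C,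
      if_pos (Int.natCast_nonneg _), Int.toNat_natCast,
      show 2 * (y + 2) + (j : ℕ) = 2 * (y + 1) + 1 + j + 1 by ring,
      PowerSeries.mk_one_pow_eq_mk_choose_add, PowerSeries.coeff_mk, Nat.choose_symm_add,
      add_right_comm]
  refine (congrArg Matrix.det hB).trans ?_
  rw [det_one_add_eq_mul_sectionDet _ _ (by omega), sectionDet_evenCoeff _ (by omega),
    sectionDet_oddCoeff _ (by omega), Nat.add_sub_cancel, prod_evenFactor_mul_prod_oddFactor,
    ← prod_div_distrib, show 2 * (y + 1) + 2 * (k + 1) = 2 * y + 2 * k + 4 by ring,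
    show y + 1 + (k + 1) - 1 = y + k + 1 by omega, Nat.add_sub_cancel]
  congr 1
  refine prod_congr rfl fun i _ => ?_
  rw [tilingFactor, div_div]
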